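/- Let N be a finite type with at least two elements, and let φ be an index on N taking only nonnegative values (φ_i(c) ≥ 0 for every credit function c and every i ∈ N). Then φ satisfies anonymity, monotonicity, and efficiency if and only if φ is the e-index, i.e. φ_i(c) = Σ_{S ⊆ N, i ∈ S} c(S)/|S| for every credit function c and every i ∈ N. (Footnote to the main theorem: the characterization continues to hold when restricted to indices that return only nonnegative values.) -/

import Mathlib

/-- A credit function on `N`: assigns a nonnegative worth to each group of
authors, with the empty group getting worth `0`. -/
def IsCredit {N : Type*} [Fintype N] [DecidableEq N] (c : Finset N → ℝ) : Prop :=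
  c ∅ = 0 ∧ ∀ S : Finset N, 0 ≤ c S

/-- The e-index: `e_i(c) = Σ_{S ⊆ N, i ∈ S} c(S)/|S|`. -/
noncomputable def eIndex {N : Type*} [Fintype N] [DecidableEq N]
    (c : Finset N → ℝ) (i : N) : ℝ :=
  ∑ S ∈ Finset.univ.powerset.filter (fun S => i ∈ S), c S / (S.card : ℝ)

/-- The permuted credit function: `(πc)(T) = c(π⁻¹(T))`. -/
def permCredit {N : Type*} [Fintype N] [DecidableEq N]
    (π : Equiv.Perm N) (c : Finset N → ℝ) : Finset N → ℝ :=
  fun T => c (T.image π.symm)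

/-- Anonymity: `φ_{π(i)}(πc) = φ_i(c)` for every permutation `π`,
credit function `c`, and author `i`. -/
def Anonymity {N : Type*} [Fintype N] [DecidableEq N]
    (φ : (Finset N → ℝ) → N → ℝ) : Prop :=
  ∀ π : Equiv.Perm N, ∀ c : Finset N → ℝ, IsCredit c →
    ∀ i : N, φ (permCredit π c) (π i) = φ c i

/-- Monotonicity: if `c(S ∪ {i}) ≥ d(S ∪ {i})` for all `S ⊆ N \ {i}`,
then `φ_i(c) ≥ φ_i(d)`. -/
def Monotonicity {N : Type*} [Fintype N] [DecidableEq N]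
    (φ : (Finset N → ℝ) → N → ℝ) : Prop :=
  ∀ c d : Finset N → ℝ, IsCredit c → IsCredit d → ∀ i : N,
    (∀ S : Finset N, i ∉ S → d (insert i S) ≤ c (insert i S)) →
    φ d i ≤ φ c i

/-- Efficiency: `Σ_{i ∈ N} φ_i(c) = Σ_{S ⊆ N, S nonempty} c(S)`. -/
def Efficiency {N : Type*} [Fintype N] [DecidableEq N]
    (φ : (Finset N → ℝ) → N → ℝ) : Prop :=
  ∀ c : Finset N → ℝ, IsCredit c →
    ∑ i : N, φ c i = ∑ S ∈ Finset.univ.powerset.filter (fun S => S.Nonempty), c S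

section

variable {N : Type*} [Fintype N] [DecidableEq N]

theorem IsCredit.permCredit {c : Finset N → ℝ} (hc : IsCredit c) (π : Equiv.Perm N) :
    IsCredit (permCredit π c) :=
  ⟨by simp [_root_.permCredit, hc.1], fun _ => hc.2 _⟩

theorem IsCredit.update_zero {c : Finset N → ℝ} (hc : IsCredit c) (S : Finset N) :
    IsCredit (Function.update c S 0) := by
  refine ⟨?_, fun T => ?_⟩
  · by_cases h : ∅ = S
    · subst h; simp
    · simp [Function.update_of_ne h, hc.1]
  · by_cases h : T = S
    · subst h; simp
    · simpa [Function.update_of_ne h] using hc.2 T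

theorem anonymity_eIndex : Anonymity (eIndex (N := N)) := by
  intro π c _ i
  unfold eIndex permCredit
  refine Finset.sum_nbij' (fun T => T.image π.symm) (fun T => T.image π) ?_ ?_ ?_ ?_ ?_
  · intro T hT
    simpa [Equiv.symm_apply_eq] using hT
  · intro T hT
    simpa using hT
  · intro T _
    simp [Finset.image_image]
  · intro T _
    simp [Finset.image_image]
  · intro T _
    rw [Finset.card_image_of_injective _ π.symm.injective]

theorem monotonicity_eIndex : Monotonicity (eIndex (N := N)) := by
  intro c d _ _ i h
  refine Finset.sum_le_sum fun S hS => ?_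
  have hi : i ∈ S := (Finset.mem_filter.1 hS).2
  have := h (S.erase i) (Finset.notMem_erase i S)
  rw [Finset.insert_erase hi] at this
  gcongr

theorem efficiency_eIndex : Efficiency (eIndex (N := N)) := by
  intro c _
  unfold eIndex
  rw [Finset.sum_comm' (t' := Finset.univ.powerset.filter (fun S : Finset N => S.Nonempty))
    (s' := fun S => S)]
  · refine Finset.sum_congr rfl fun S hS => ?_
    have hne : (S.card : ℝ) ≠ 0 := by
      exact_mod_cast (Finset.card_pos.2 (Finset.mem_filter.1 hS).2).ne'
    rw [Finset.sum_const, nsmul_eq_mul]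
    field_simp
  · intro i S
    simp only [Finset.mem_univ, true_and, Finset.mem_filter, Finset.powerset_univ]
    exact ⟨fun h => ⟨h, i, h⟩, fun h => h.1⟩

/-- Under monotonicity, an author's index depends only on the groups containing that author. -/
theorem Monotonicity.eq_of_forall_mem {φ : (Finset N → ℝ) → N → ℝ} (hφ : Monotonicity φ)
    {c d : Finset N → ℝ} (hc : IsCredit c) (hd : IsCredit d) {i : N}
    (h : ∀ S, i ∈ S → c S = d S) : φ c i = φ d i :=
  le_antisymm
    (hφ d c hd hc i fun S _ => (h _ (Finset.mem_insert_self i S)).le)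
    (hφ c d hc hd i fun S _ => (h _ (Finset.mem_insert_self i S)).ge)

/-- Swapping two authors who belong to every group of nonzero worth leaves the credit function
unchanged. -/
theorem permCredit_swap_eq_self {c : Finset N → ℝ} {i j : N}
    (hi : ∀ S, c S ≠ 0 → i ∈ S) (hj : ∀ S, c S ≠ 0 → j ∈ S) :
    permCredit (Equiv.swap i j) c = c := by
  have image_eq (S : Finset N) (h : i ∈ S ∧ j ∈ S) : S.image (Equiv.swap i j) = S := by
    refine Finset.eq_of_subset_of_card_le (fun x hx => ?_) ?_
    · obtain ⟨y, hy, rfl⟩ := Finset.mem_image.1 hx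
      rw [Equiv.swap_apply_def]
      split_ifs
      exacts [h.2, h.1, hy]
    · rw [Finset.card_image_of_injective _ (Equiv.swap i j).injective]
  funext T
  simp only [permCredit, Equiv.symm_swap]
  by_cases hT : c T = 0
  · by_contra hne
    rw [hT] at hne
    have := image_eq _ ⟨hi _ hne, hj _ hne⟩
    rw [Finset.image_image] at this
    simp only [← Equiv.coe_trans, Equiv.swap_swap, Equiv.coe_refl, Finset.image_id] at this
    exact hne (this ▸ hT)
  · rw [image_eq T ⟨hi T hT, hj T hT⟩]

theorem Anonymity.eq_of_forall_mem {φ : (Finset N → ℝ) → N → ℝ} (hφ : Anonymity φ)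
    {c : Finset N → ℝ} (hc : IsCredit c) {i j : N}
    (hi : ∀ S, c S ≠ 0 → i ∈ S) (hj : ∀ S, c S ≠ 0 → j ∈ S) : φ c i = φ c j := by
  have := hφ (Equiv.swap i j) c hc i
  rw [permCredit_swap_eq_self hi hj, Equiv.swap_apply_left] at this
  exact this.symm

/-- Anonymity, monotonicity and efficiency determine an index on credit functions. -/
theorem index_unique {φ ψ : (Finset N → ℝ) → N → ℝ}
    (hφa : Anonymity φ) (hφm : Monotonicity φ) (hφe : Efficiency φ)
    (hψa : Anonymity ψ) (hψm : Monotonicity ψ) (hψe : Efficiency ψ)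
    {c : Finset N → ℝ} (hc : IsCredit c) (i : N) : φ c i = ψ c i := by
  induction hn : (Finset.univ.filter fun S => c S ≠ 0).card using Nat.strong_induction_on
    generalizing c i with
  | _ n ih =>
  have off (j : N) (hj : ¬ ∀ S, c S ≠ 0 → j ∈ S) : φ c j = ψ c j := by
    push Not at hj
    obtain ⟨S, hS, hjS⟩ := hj
    have hc' := hc.update_zero S
    have agree : ∀ T, j ∈ T → c T = Function.update c S 0 T := fun T hT =>
      (Function.update_of_ne (by rintro rfl; exact hjS hT) _ _).symm
    rw [hφm.eq_of_forall_mem hc hc' agree, hψm.eq_of_forall_mem hc hc' agree]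
    refine ih _ ?_ hc' j rfl
    rw [← hn]
    refine Finset.card_lt_card (Finset.ssubset_iff_of_subset (fun T hT => ?_) |>.2 ⟨S, ?_, ?_⟩)
    · by_cases h : T = S
      · simp [h] at hT
      · simpa [Function.update_of_ne h] using hT
    · simpa using hS
    · simp
  by_cases hi : ∀ S, c S ≠ 0 → i ∈ S
  · have hsum : ∑ j, (φ c j - ψ c j) = 0 := by
      rw [Finset.sum_sub_distrib, hφe c hc, hψe c hc, sub_self]
    by_contra hne
    have const (j : N) (hj : ∀ S, c S ≠ 0 → j ∈ S) : φ c j - ψ c j = φ c i - ψ c i := by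
      rw [hφa.eq_of_forall_mem hc hj hi, hψa.eq_of_forall_mem hc hj hi]
    rcases lt_or_gt_of_ne hne with h | h
    · refine (Finset.sum_neg' (fun j _ => ?_) ⟨i, Finset.mem_univ i, sub_neg.2 h⟩).ne hsum
      by_cases hj : ∀ S, c S ≠ 0 → j ∈ S
      · rw [const j hj]; exact (sub_neg.2 h).le
      · rw [off j hj, sub_self]
    · refine (Finset.sum_pos' (fun j _ => ?_) ⟨i, Finset.mem_univ i, sub_pos.2 h⟩).ne' hsum
      by_cases hj : ∀ S, c S ≠ 0 → j ∈ S
      · rw [const j hj]; exact (sub_pos.2 h).le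
      · rw [off j hj, sub_self]
  · exact off i hi

end

/-- The characterization continues to hold when restricted to indices returning
only nonnegative values. -/
theorem index_characterization_nonneg {N : Type*} [Fintype N] [DecidableEq N] [Nontrivial N]
    (φ : (Finset N → ℝ) → N → ℝ)
    (hpos : ∀ c : Finset N → ℝ, IsCredit c → ∀ i : N, 0 ≤ φ c i) :
    (Anonymity φ ∧ Monotonicity φ ∧ Efficiency φ) ↔
      (∀ c : Finset N → ℝ, IsCredit c → ∀ i : N, φ c i = eIndex c i) := by
  constructor
  · rintro ⟨ha, hm, he⟩ c hc i
    exact index_unique ha hm he anonymity_eIndex monotonicity_eIndex efficiency_eIndex hc i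
  · intro h
    refine ⟨fun π c hc i => ?_, fun c d hc hd i hcd => ?_, fun c hc => ?_⟩
    · rw [h _ (hc.permCredit π), h c hc, anonymity_eIndex π c hc i]
    · rw [h c hc, h d hd]
      exact monotonicity_eIndex c d hc hd i hcd
    · rw [Finset.sum_congr rfl fun i _ => h c hc i, efficiency_eIndex c hc]
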